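/- arXiv:2211.14199 — 6 statements merged into one kernel-verified Lean document; each statement's English description precedes it below -/
import Mathlib

section
/- Let n ≥ 1, let E ∈ ℝ, let V : EuclideanSpace ℝ (Fin n) → ℝ be differentiable with V(p) < E for all p, and set η(p) := √(2(E − V(p))). Let m > 0 and let x : ℝ → EuclideanSpace ℝ (Fin n) be twice differentiable satisfying Newton's equation m • x''(t) = −gradient V (x(t)) for all t and the energy relation (m/2)·‖x'(t)‖² + V(x(t)) = E for all t (so in particular x'(t) ≠ 0). Then for every t ∈ ℝ the curve satisfies the eikonal equation in time parametrization: the derivative at t of the map s ↦ η(x(s)) • (x'(s)/‖x'(s)‖) equals ‖x'(t)‖ • gradient η (x(t)). -/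
open scoped RealInnerProductSpace

/-- The gradient of the refractive index `√(2 (E - V))` of a potential `V` below the energy `E`. -/
theorem hasGradientAt_sqrt_two_mul_sub {F : Type*} [NormedAddCommGroup F] [InnerProductSpace ℝ F]
    [CompleteSpace F] {V : F → ℝ} {g p : F} {E : ℝ} (hV : HasGradientAt V g p) (hE : V p < E) :
    HasGradientAt (fun q => Real.sqrt (2 * (E - V q))) (-(Real.sqrt (2 * (E - V p)))⁻¹ • g) p := by
  rw [hasGradientAt_iff_hasFDerivAt] at hV ⊢
  have hpos : 0 < 2 * (E - V p) := by linarith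
  refine (((hV.const_sub E).const_mul 2).sqrt hpos.ne').congr_fderiv ?_
  ext v
  simp
  field_simp

/-- **Maupertuis's principle / eikonal equation in time parametrization.**
Let `V` be a differentiable potential with `V p < E` everywhere, and set
`η p := √(2 (E - V p))`.  If `x` is a twice differentiable curve satisfying
Newton's equation `m • x'' t = -gradient V (x t)` and the energy relation
`(m/2) ‖x' t‖² + V (x t) = E`, then the map `s ↦ η (x s) • (x' s / ‖x' s‖)`
has derivative `‖x' t‖ • gradient η (x t)` at every `t`. -/
theorem eikonal_equation (n : ℕ) (hn : 1 ≤ n) (E : ℝ)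
    (V : EuclideanSpace ℝ (Fin n) → ℝ) (hV : Differentiable ℝ V)
    (hVE : ∀ p : EuclideanSpace ℝ (Fin n), V p < E)
    (η : EuclideanSpace ℝ (Fin n) → ℝ)
    (hη : ∀ p, η p = Real.sqrt (2 * (E - V p)))
    (m : ℝ) (hm : 0 < m)
    (x x' x'' : ℝ → EuclideanSpace ℝ (Fin n))
    (hx : ∀ t : ℝ, HasDerivAt x (x' t) t)
    (hx' : ∀ t : ℝ, HasDerivAt x' (x'' t) t)
    (hNewton : ∀ t : ℝ, m • x'' t = -gradient V (x t))
    (hEnergy : ∀ t : ℝ, (m / 2) * ‖x' t‖ ^ 2 + V (x t) = E) :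
    ∀ t : ℝ,
      HasDerivAt (fun s : ℝ => η (x s) • (‖x' s‖⁻¹ • x' s))
        (‖x' t‖ • gradient η (x t)) t := by
  intro t
  have hsqrt : 0 < Real.sqrt m := Real.sqrt_pos.2 hm
  have hspeed : ∀ s, η (x s) = Real.sqrt m * ‖x' s‖ := fun s => by
    rw [hη, ← hEnergy s, ← Real.sqrt_sq (norm_nonneg (x' s)), ← Real.sqrt_mul hm.le,
      Real.sqrt_sq (norm_nonneg (x' s))]
    congr 1
    ring
  have hne : ∀ s, ‖x' s‖ ≠ 0 := fun s h => by
    have henergy := hEnergy s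
    have hlt := hVE (x s)
    rw [h] at henergy
    linarith
  have hmomentum : (fun s : ℝ => η (x s) • (‖x' s‖⁻¹ • x' s)) = fun s => Real.sqrt m • x' s := by
    funext s
    rw [hspeed, smul_smul, mul_assoc, mul_inv_cancel₀ (hne s), mul_one]
  have hgrad : gradient η (x t) = -(Real.sqrt m * ‖x' t‖)⁻¹ • gradient V (x t) := by
    rw [← hspeed t, hη, funext hη]
    exact (hasGradientAt_sqrt_two_mul_sub (hV (x t)).hasGradientAt (hVE (x t))).gradient
  have hforce : gradient V (x t) = -(m • x'' t) := by rw [hNewton, neg_neg]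
  have hderiv : ‖x' t‖ • gradient η (x t) = Real.sqrt m • x'' t := by
    rw [hgrad, hforce, smul_neg, neg_smul, neg_neg, smul_smul, smul_smul]
    congr 1
    have := hne t
    field_simp
    exact (Real.sq_sqrt hm.le).symm
  rw [hmomentum, hderiv]
  exact (hx' t).const_smul (Real.sqrt m)
end

section
/- Let H be a real inner product space, let n ∈ H be a unit vector, and for v ∈ H let P v := v − ⟨v, n⟩ • n denote the orthogonal projection onto the hyperplane {w : ⟨w, n⟩ = 0}. Let η₁, η₂ > 0 and let u⁻, u⁺ ∈ H be unit vectors such that η₁·⟨u⁻, w⟩ = η₂·⟨u⁺, w⟩ for all w with ⟨w, n⟩ = 0. Then: (i) η₁·‖P u⁻‖ = η₂·‖P u⁺‖, i.e. sin θ⁺ / sin θ⁻ = η₁/η₂ where sin θ± := ‖P u±‖ are the sines of the angles u± make with n (whenever ‖P u⁻‖ ≠ 0); and (ii) u⁺ lies in the linear span of u⁻ and n. -/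
open scoped RealInnerProductSpace

/-- **Snell's law, coordinate form.**  Let `n` be a unit vector in a real inner
product space `H` and `P v := v - ⟪v, n⟫ • n` the orthogonal projection onto the
hyperplane orthogonal to `n`.  If `u⁻, u⁺` are unit vectors with
`η₁ ⟪u⁻, w⟫ = η₂ ⟪u⁺, w⟫` for every `w` orthogonal to `n` (with `η₁, η₂ > 0`),
then (i) `η₁ ‖P u⁻‖ = η₂ ‖P u⁺‖`, i.e. `sin θ⁺ / sin θ⁻ = η₁ / η₂` whenever
`‖P u⁻‖ ≠ 0`, and (ii) `u⁺` lies in the span of `u⁻` and `n`. -/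
theorem snell_law_coordinate_form {H : Type*} [NormedAddCommGroup H]
    [InnerProductSpace ℝ H] (n : H) (hn : ‖n‖ = 1)
    (P : H → H) (hP : ∀ v : H, P v = v - ⟪v, n⟫ • n)
    (η₁ η₂ : ℝ) (hη₁ : 0 < η₁) (hη₂ : 0 < η₂)
    (um up : H) (hum : ‖um‖ = 1) (hup : ‖up‖ = 1)
    (hsnell : ∀ w : H, ⟪w, n⟫ = 0 → η₁ * ⟪um, w⟫ = η₂ * ⟪up, w⟫) :
    η₁ * ‖P um‖ = η₂ * ‖P up‖ ∧
      (‖P um‖ ≠ 0 → ‖P up‖ / ‖P um‖ = η₁ / η₂) ∧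
      up ∈ Submodule.span ℝ ({um, n} : Set H) := by
  have hPn : ∀ v : H, ⟪P v, n⟫ = 0 := fun v => by
    rw [hP, inner_sub_left, real_inner_smul_left, real_inner_self_eq_norm_sq, hn]
    ring
  have hPw : ∀ v w : H, ⟪w, n⟫ = 0 → ⟪P v, w⟫ = ⟪v, w⟫ := fun v w hw => by
    rw [hP, inner_sub_left, real_inner_smul_left, real_inner_comm w n, hw]
    ring
  have hproj : η₁ • P um = η₂ • P up := by
    have hw : ⟪η₁ • P um - η₂ • P up, n⟫ = 0 := by
      rw [inner_sub_left, real_inner_smul_left, real_inner_smul_left, hPn, hPn]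
      ring
    rw [← sub_eq_zero, ← inner_self_eq_zero (𝕜 := ℝ)]
    generalize hwdef : η₁ • P um - η₂ • P up = w at hw
    nth_rewrite 1 [← hwdef]
    rw [inner_sub_left, real_inner_smul_left, real_inner_smul_left, hPw _ _ hw, hPw _ _ hw,
      hsnell w hw, sub_self]
  have hnorm : η₁ * ‖P um‖ = η₂ * ‖P up‖ := by
    simpa [norm_smul, abs_of_pos hη₁, abs_of_pos hη₂] using congrArg norm hproj
  refine ⟨hnorm, fun h => ?_, ?_⟩
  · rw [div_eq_div_iff h hη₂.ne', hnorm, mul_comm]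
  · have hup_eq : up = (η₂⁻¹ * η₁) • (um - ⟪um, n⟫ • n) + ⟪up, n⟫ • n := by
      rw [← hP, mul_smul, hproj, inv_smul_smul₀ hη₂.ne', hP, sub_add_cancel]
    have hum_mem : um ∈ Submodule.span ℝ ({um, n} : Set H) := Submodule.subset_span (by simp)
    have hn_mem : n ∈ Submodule.span ℝ ({um, n} : Set H) := Submodule.subset_span (by simp)
    rw [hup_eq]
    exact add_mem (Submodule.smul_mem _ _ (sub_mem hum_mem (Submodule.smul_mem _ _ hn_mem)))
      (Submodule.smul_mem _ _ hn_mem)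
end

section
/- Let H be a real inner product space, let n ∈ H be a unit vector, m > 0, E, C₁, C₂ ∈ ℝ with E > C₁ and E > C₂. Let v⁻ = v_τ + v_n • n with ⟨v_τ, n⟩ = 0, v⁻ ≠ 0, (m/2)·‖v⁻‖² + C₁ = E, and v_n² > (2/m)(C₂ − C₁), and let v⁺ := v_τ + √(v_n² − (2/m)(C₂ − C₁)) • n be the refracted velocity. Define sin θ⁻ := ‖v_τ‖/‖v⁻‖ and sin θ⁺ := ‖v_τ‖/‖v⁺‖ (the sines of the angles v⁻ and v⁺ make with n). Then Snell's law holds in the mechanical form √(E − C₂) · sin θ⁺ = √(E − C₁) · sin θ⁻. -/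
open scoped RealInnerProductSpace

/-- Pythagoras for the decomposition of a vector into its tangential and normal components. -/
lemma norm_add_smul_sq_of_inner_eq_zero {H : Type*} [NormedAddCommGroup H]
    [InnerProductSpace ℝ H] {u n : H} (hn : ‖n‖ = 1) (hu : ⟪u, n⟫ = 0) (a : ℝ) :
    ‖u + a • n‖ ^ 2 = ‖u‖ ^ 2 + a ^ 2 := by
  rw [norm_add_sq_real, inner_smul_right, hu, norm_smul, hn, Real.norm_eq_abs, mul_one, sq_abs]
  ring

/-- The refractive index cancels the speed when the kinetic energy `(m / 2) * s ^ 2` equals `K`. -/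
lemma sqrt_mul_div_of_kinetic_energy_eq {m K s : ℝ} (hK : 0 < K) (hs : 0 ≤ s)
    (h : m / 2 * s ^ 2 = K) (t : ℝ) : √K * (t / s) = √(m / 2) * t := by
  have hs0 : s ≠ 0 := by
    rintro rfl
    simp at h
    exact hK.ne h
  rw [← h, Real.sqrt_mul' _ (sq_nonneg s), Real.sqrt_sq hs]
  field_simp

/-- **Snell's law, mechanical form.**  With `n` a unit vector, `v⁻ = v_τ + v_n • n`
(`⟪v_τ, n⟫ = 0`, `v⁻ ≠ 0`) of total energy `(m/2) ‖v⁻‖² + C₁ = E`, and refraction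
condition `v_n² > (2/m)(C₂ - C₁)`, the refracted velocity
`v⁺ := v_τ + √(v_n² - (2/m)(C₂ - C₁)) • n` satisfies
`√(E - C₂) * (‖v_τ‖/‖v⁺‖) = √(E - C₁) * (‖v_τ‖/‖v⁻‖)`, i.e.
`√(E - C₂) sin θ⁺ = √(E - C₁) sin θ⁻`. -/
theorem snell_law_mechanical {H : Type*} [NormedAddCommGroup H]
    [InnerProductSpace ℝ H] (n : H) (hn : ‖n‖ = 1)
    (m E C₁ C₂ : ℝ) (hm : 0 < m) (hE₁ : C₁ < E) (hE₂ : C₂ < E)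
    (vτ : H) (vn : ℝ) (hτ : ⟪vτ, n⟫ = 0)
    (vminus : H) (hvminus : vminus = vτ + vn • n) (hne : vminus ≠ 0)
    (henergy : (m / 2) * ‖vminus‖ ^ 2 + C₁ = E)
    (hrefr : vn ^ 2 > (2 / m) * (C₂ - C₁))
    (vplus : H)
    (hvplus : vplus = vτ + Real.sqrt (vn ^ 2 - (2 / m) * (C₂ - C₁)) • n)
    (sinθminus sinθplus : ℝ)
    (hsinm : sinθminus = ‖vτ‖ / ‖vminus‖) (hsinp : sinθplus = ‖vτ‖ / ‖vplus‖) :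
    Real.sqrt (E - C₂) * sinθplus = Real.sqrt (E - C₁) * sinθminus := by
  have hplus : m / 2 * ‖vplus‖ ^ 2 = E - C₂ := by
    rw [hvminus, norm_add_smul_sq_of_inner_eq_zero hn hτ] at henergy
    rw [hvplus, norm_add_smul_sq_of_inner_eq_zero hn hτ, Real.sq_sqrt (sub_nonneg.2 hrefr.le),
      ← henergy]
    field_simp
    ring
  rw [hsinm, hsinp,
    sqrt_mul_div_of_kinetic_energy_eq (sub_pos.2 hE₂) (norm_nonneg _) hplus,
    sqrt_mul_div_of_kinetic_energy_eq (sub_pos.2 hE₁) (norm_nonneg _) (eq_sub_of_add_eq henergy)]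
end

section
/- Let 0 < r₀ < 1 and let μ be the cosine-law probability measure on (−π/2, π/2), i.e. the measure with density θ ↦ (1/2)·cos θ with respect to Lebesgue measure. Let A := {θ ∈ (−π/2, π/2) : |sin θ| < r₀}. Then μ(A) = r₀, and the pushforward under the refraction map θ ↦ arcsin(sin θ / r₀) of the conditional probability measure μ(· | A) = r₀⁻¹ · μ restricted to A is again the cosine-law probability measure μ. In other words, if the incidence angle is cosine-law distributed, then conditional on refraction occurring (|sin θ| < r₀) the refracted angle φ, determined by Snell's law sin φ = sin θ / r₀, is again cosine-law distributed. -/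
open MeasureTheory Real

/-- The cosine-law measure on `(-π/2, π/2)`, with density `θ ↦ (1/2) cos θ`. -/
noncomputable def cosineLaw : Measure ℝ :=
  (volume.restrict (Set.Ioo (-(π / 2)) (π / 2))).withDensity
    fun θ => ENNReal.ofReal ((1 / 2) * Real.cos θ)

lemma image_sin_preimage_inter_Ioo (T : Set ℝ) :
    Real.sin '' (Real.sin ⁻¹' T ∩ Set.Ioo (-(π / 2)) (π / 2)) = T ∩ Set.Ioo (-1) 1 := by
  ext x
  constructor
  · rintro ⟨θ, ⟨hT, hθ⟩, rfl⟩
    refine ⟨hT, ?_, ?_⟩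
    · simpa using Real.sin_lt_sin_of_lt_of_le_pi_div_two le_rfl hθ.2.le hθ.1
    · simpa using Real.sin_lt_sin_of_lt_of_le_pi_div_two hθ.1.le le_rfl hθ.2
  · rintro ⟨hT, hx⟩
    have hsin := Real.sin_arcsin hx.1.le hx.2.le
    exact ⟨Real.arcsin x, ⟨by simpa [hsin] using hT,
      Real.neg_pi_div_two_lt_arcsin.2 hx.1, Real.arcsin_lt_pi_div_two.2 hx.2⟩, hsin⟩

/-- The sine of a cosine-law distributed angle is uniformly distributed on `(-1, 1)`. -/
lemma map_sin_cosineLaw :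
    Measure.map Real.sin cosineLaw = (2 : ENNReal)⁻¹ • volume.restrict (Set.Ioo (-1) 1) := by
  ext T hT
  have hpre : MeasurableSet (Real.sin ⁻¹' T) := Real.measurable_sin hT
  have hs : MeasurableSet (Real.sin ⁻¹' T ∩ Set.Ioo (-(π / 2)) (π / 2)) :=
    hpre.inter measurableSet_Ioo
  rw [Measure.map_apply Real.measurable_sin hT, cosineLaw, withDensity_apply _ hpre,
    Measure.restrict_restrict hpre, Measure.smul_apply, Measure.restrict_apply hT,
    ← image_sin_preimage_inter_Ioo, smul_eq_mul, ← setLIntegral_const,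
    lintegral_image_eq_lintegral_abs_deriv_mul hs
      (fun θ _ => (Real.hasDerivAt_sin θ).hasDerivWithinAt)
      (Real.injOn_sin.mono fun θ hθ => Set.Ioo_subset_Icc_self hθ.2)]
  refine setLIntegral_congr_fun hs fun θ hθ => ?_
  have hcos : 0 ≤ Real.cos θ := (Real.cos_pos_of_mem_Ioo hθ.2).le
  simp only [abs_of_nonneg hcos]
  rw [mul_comm (1 / 2 : ℝ), ENNReal.ofReal_mul hcos, one_div,
    ENNReal.ofReal_inv_of_pos two_pos, ENNReal.ofReal_ofNat]

lemma ae_cosineLaw_mem_Ioo : ∀ᵐ θ ∂cosineLaw, θ ∈ Set.Ioo (-(π / 2)) (π / 2) :=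
  (withDensity_absolutelyContinuous _ _).ae_le (ae_restrict_mem measurableSet_Ioo)

lemma map_arcsin_uniform :
    Measure.map Real.arcsin ((2 : ENNReal)⁻¹ • volume.restrict (Set.Ioo (-1) 1)) = cosineLaw := by
  rw [← map_sin_cosineLaw, Measure.map_map Real.measurable_arcsin Real.measurable_sin]
  conv_rhs => rw [← Measure.map_id (μ := cosineLaw)]
  refine Measure.map_congr ?_
  filter_upwards [ae_cosineLaw_mem_Ioo] with θ hθ
  exact Real.arcsin_sin hθ.1.le hθ.2.le

lemma map_div_volume_restrict_Ioo {r : ℝ} (hr : 0 < r) :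
    Measure.map (fun x => x / r) (volume.restrict (Set.Ioo (-r) r)) =
      ENNReal.ofReal r • volume.restrict (Set.Ioo (-1) 1) := by
  have hpre : Set.Ioo (-r) r = (fun x => x / r) ⁻¹' Set.Ioo (-1) 1 := by
    ext x
    simp [lt_div_iff₀ hr, div_lt_iff₀ hr]
  have hmap : Measure.map (fun x => x / r) volume = ENNReal.ofReal r • (volume : Measure ℝ) := by
    simpa [div_eq_mul_inv, abs_of_pos hr] using Real.map_volume_mul_right (inv_ne_zero hr.ne')
  rw [hpre, ← Measure.restrict_map (by fun_prop) measurableSet_Ioo, hmap, Measure.restrict_smul]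

/-- **Refraction preserves the cosine law (planar case).**  Let `μ` be the
cosine-law probability measure on `(-π/2, π/2)` (density `θ ↦ (1/2) cos θ`),
let `0 < r₀ < 1` and `A := {θ ∈ (-π/2, π/2) : |sin θ| < r₀}`.  Then `μ A = r₀`,
and the pushforward under the refraction map `θ ↦ arcsin (sin θ / r₀)` of the
conditional probability measure `μ(·|A) = r₀⁻¹ • μ|_A` is again `μ`. -/
theorem refraction_preserves_cosine_law
    (r₀ : ℝ) (hr₀ : 0 < r₀) (hr₀1 : r₀ < 1)
    (μ : Measure ℝ)
    (hμ : μ = (volume.restrict (Set.Ioo (-(π / 2)) (π / 2))).withDensity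
      fun θ => ENNReal.ofReal ((1 / 2) * Real.cos θ))
    (A : Set ℝ)
    (hA : A = {θ : ℝ | θ ∈ Set.Ioo (-(π / 2)) (π / 2) ∧ |Real.sin θ| < r₀}) :
    μ A = ENNReal.ofReal r₀ ∧
      Measure.map (fun θ => Real.arcsin (Real.sin θ / r₀))
        ((ENNReal.ofReal r₀)⁻¹ • μ.restrict A) = μ := by
  change μ = cosineLaw at hμ
  subst hμ
  have hsub : Set.Ioo (-r₀) r₀ ⊆ Set.Ioo (-1) 1 :=
    Set.Ioo_subset_Ioo (neg_le_neg hr₀1.le) hr₀1.le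
  have hAe : A =ᵐ[cosineLaw] Real.sin ⁻¹' Set.Ioo (-r₀) r₀ := by
    filter_upwards [ae_cosineLaw_mem_Ioo] with θ hθ
    refine propext (?_ : θ ∈ A ↔ θ ∈ Real.sin ⁻¹' Set.Ioo (-r₀) r₀)
    rw [hA, Set.mem_preimage, Set.mem_Ioo, ← abs_lt]
    exact and_iff_right hθ
  have hr0 : ENNReal.ofReal r₀ ≠ 0 := by simpa using hr₀
  constructor
  · rw [measure_congr hAe, ← Measure.map_apply Real.measurable_sin measurableSet_Ioo,
      map_sin_cosineLaw, Measure.smul_apply, Measure.restrict_apply measurableSet_Ioo,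
      Set.inter_eq_left.2 hsub, Real.volume_Ioo, smul_eq_mul, sub_neg_eq_add, ← two_mul,
      ENNReal.ofReal_mul two_pos.le, ENNReal.ofReal_ofNat, ← mul_assoc,
      ENNReal.inv_mul_cancel two_ne_zero ENNReal.ofNat_ne_top, one_mul]
  · have hcomp : (fun θ => Real.arcsin (Real.sin θ / r₀)) =
        Real.arcsin ∘ (fun x => x / r₀) ∘ Real.sin := rfl
    have hdiv : Measurable fun x : ℝ => x / r₀ := by fun_prop
    rw [Measure.map_smul, Measure.restrict_congr_set hAe, hcomp,
      ← Measure.map_map Real.measurable_arcsin (hdiv.comp Real.measurable_sin),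
      ← Measure.map_map hdiv Real.measurable_sin,
      ← Measure.restrict_map Real.measurable_sin measurableSet_Ioo, map_sin_cosineLaw,
      Measure.restrict_smul, Measure.restrict_restrict measurableSet_Ioo,
      Set.inter_eq_left.2 hsub, Measure.map_smul, map_div_volume_restrict_Ioo hr₀,
      smul_comm, Measure.map_smul, ← smul_assoc, smul_eq_mul,
      ENNReal.inv_mul_cancel hr0 ENNReal.ofReal_ne_top, one_smul, map_arcsin_uniform]
end

section
/- (First row of the differential of the lensed billiard map.) Work in ℝ² with the standard inner product; let R_θ denote rotation by angle θ counterclockwise and J = R_{π/2}. Let γ₁, γ₂ : ℝ → ℝ² be C¹ curves with ‖γᵢ'(x)‖ = 1 for all x; set tᵢ(x) := γᵢ'(x), nᵢ(x) := J tᵢ(x), 𝒪ᵢ := γᵢ(0), ℓ := ‖𝒪₂ − 𝒪₁‖. Let v₁ ∈ ℝ² be nonzero with 𝒪₂ = 𝒪₁ + (ℓ/‖v₁‖) • v₁, and set ν₁ := v₁/‖v₁‖. Suppose x₂, t : ℝ × ℝ → ℝ are differentiable at (0,0), with x₂(0,0) = 0, t(0,0) = ℓ/‖v₁‖, and γ₂(x₂(x₁,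 θ₁)) = γ₁(x₁) + t(x₁, θ₁) • (R_{θ₁} v₁) for all (x₁, θ₁) in a neighborhood of (0,0). If ⟨ν₁, n₂(0)⟩ ≠ 0, then ∂x₂/∂x₁(0,0) = ⟨ν₁, n₁(0)⟩ / ⟨ν₁, n₂(0)⟩ and ∂x₂/∂θ₁(0,0) = −ℓ / ⟨ν₁, n₂(0)⟩. -/
open scoped RealInnerProductSpace

/-- Directional derivative of the free-flight equation. -/
theorem free_flight_directional_derivative {γ₁ γ₂ : ℝ → ℂ} {x₂ t : ℝ × ℝ → ℝ} {v : ℂ}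
    (hγ₁ : DifferentiableAt ℝ γ₁ 0) (hγ₂ : DifferentiableAt ℝ γ₂ 0)
    (hx₂ : DifferentiableAt ℝ x₂ (0, 0)) (ht : DifferentiableAt ℝ t (0, 0))
    (hx₂0 : x₂ (0, 0) = 0)
    (heq : ∀ᶠ p : ℝ × ℝ in nhds (0, 0),
      γ₂ (x₂ p) = γ₁ p.1 + t p • (Complex.exp (p.2 * Complex.I) * v))
    (a b : ℝ) :
    fderiv ℝ x₂ (0, 0) (a, b) • deriv γ₂ 0 =
      a • deriv γ₁ 0 + fderiv ℝ t (0, 0) (a, b) • v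
        + (t (0, 0) * b) • (Complex.I * v) := by
  have hline (c : ℝ) : HasDerivAt (fun s : ℝ => s * c) c 0 := by
    simpa using (hasDerivAt_id (0 : ℝ)).mul_const c
  have hc : HasDerivAt (fun s : ℝ => (s * a, s * b)) (a, b) 0 := (hline a).prodMk (hline b)
  have hc0 : ((0 : ℝ) * a, (0 : ℝ) * b) = (0, 0) := by simp
  have hx : HasDerivAt (fun s : ℝ => x₂ (s * a, s * b)) (fderiv ℝ x₂ (0, 0) (a, b)) 0 :=
    hx₂.hasFDerivAt.comp_hasDerivAt_of_eq 0 hc hc0.symm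
  have hT : HasDerivAt (fun s : ℝ => t (s * a, s * b)) (fderiv ℝ t (0, 0) (a, b)) 0 :=
    ht.hasFDerivAt.comp_hasDerivAt_of_eq 0 hc hc0.symm
  have hleft : HasDerivAt (fun s : ℝ => γ₂ (x₂ (s * a, s * b)))
      (fderiv ℝ x₂ (0, 0) (a, b) • deriv γ₂ 0) 0 :=
    hγ₂.hasDerivAt.scomp_of_eq 0 hx (by simp [hx₂0])
  have hbase : HasDerivAt (fun s : ℝ => γ₁ (s * a)) (a • deriv γ₁ 0) 0 :=
    hγ₁.hasDerivAt.scomp_of_eq 0 (hline a) (by simp)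
  have hrot : HasDerivAt (fun s : ℝ => Complex.exp ((s * b : ℝ) * Complex.I) * v)
      (b * Complex.I * v) 0 := by
    simpa using (((hline b).ofReal_comp.mul_const Complex.I).cexp).mul_const v
  have hright := hbase.add (hT.smul hrot)
  have hcurve : Filter.Tendsto (fun s : ℝ => (s * a, s * b)) (nhds 0) (nhds (0, 0)) := by
    simpa using hc.continuousAt.tendsto
  have h := hleft.unique (hright.congr_of_eventuallyEq (hcurve.eventually heq))
  rw [h]
  simp only [zero_mul, Complex.ofReal_zero, Complex.exp_zero, one_mul, Complex.real_smul,
    Complex.ofReal_mul]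
  ring

/-- **First row of the differential of the lensed billiard map.**  We work in
`ℝ² ≅ ℂ` with its standard inner product; `R θ` is the rotation by angle `θ`
counterclockwise (multiplication by `exp (θ i)`) and `J = R_{π/2}`
(multiplication by `i`).  The curves `γ₁, γ₂` are unit-speed (`C¹`)
parametrizations of the boundary pieces, with tangents `tᵢ = γᵢ'`, normals
`nᵢ = J γᵢ'`, base points `𝒪ᵢ = γᵢ 0`, flight length `ℓ = ‖𝒪₂ - 𝒪₁‖`, initial
velocity `v₁ ≠ 0` with `𝒪₂ = 𝒪₁ + (ℓ/‖v₁‖) • v₁` and unit velocity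
`ν₁ = v₁/‖v₁‖`.  If `x₂, t` satisfy the free-flight equation
`γ₂ (x₂ (x₁, θ₁)) = γ₁ x₁ + t (x₁, θ₁) • R θ₁ v₁` near `(0,0)` and
`⟪ν₁, n₂ 0⟫ ≠ 0`, then `∂x₂/∂x₁ (0,0) = ⟪ν₁, n₁ 0⟫ / ⟪ν₁, n₂ 0⟫` and
`∂x₂/∂θ₁ (0,0) = -ℓ / ⟪ν₁, n₂ 0⟫`. -/
theorem lensed_billiard_differential_first_row
    (R : ℝ → ℂ → ℂ) (hR : ∀ (θ : ℝ) (v : ℂ), R θ v = Complex.exp (θ * Complex.I) * v)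
    (J : ℂ → ℂ) (hJ : ∀ v : ℂ, J v = Complex.I * v)
    (γ₁ γ₂ : ℝ → ℂ) (hγ₁ : ContDiff ℝ 1 γ₁) (hγ₂ : ContDiff ℝ 1 γ₂)
    (hunit₁ : ∀ x : ℝ, ‖deriv γ₁ x‖ = 1) (hunit₂ : ∀ x : ℝ, ‖deriv γ₂ x‖ = 1)
    (ℓ : ℝ) (hℓ : ℓ = ‖γ₂ 0 - γ₁ 0‖)
    (v₁ : ℂ) (hv₁ : v₁ ≠ 0)
    (hO₂ : γ₂ 0 = γ₁ 0 + (ℓ / ‖v₁‖) • v₁)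
    (ν₁ : ℂ) (hν₁ : ν₁ = ‖v₁‖⁻¹ • v₁)
    (x₂ t : ℝ × ℝ → ℝ)
    (hx₂d : DifferentiableAt ℝ x₂ (0, 0)) (htd : DifferentiableAt ℝ t (0, 0))
    (hx₂0 : x₂ (0, 0) = 0) (ht0 : t (0, 0) = ℓ / ‖v₁‖)
    (heq : ∀ᶠ p : ℝ × ℝ in nhds (0, 0), γ₂ (x₂ p) = γ₁ p.1 + t p • R p.2 v₁)
    (hne : ⟪ν₁, J (deriv γ₂ 0)⟫ ≠ 0) :
    fderiv ℝ x₂ (0, 0) (1, 0) = ⟪ν₁, J (deriv γ₁ 0)⟫ / ⟪ν₁, J (deriv γ₂ 0)⟫ ∧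
      fderiv ℝ x₂ (0, 0) (0, 1) = -ℓ / ⟪ν₁, J (deriv γ₂ 0)⟫ := by
  have hv : ‖v₁‖ ≠ 0 := norm_ne_zero_iff.mpr hv₁
  have key (a b : ℝ) : fderiv ℝ x₂ (0, 0) (a, b) * ⟪ν₁, J (deriv γ₂ 0)⟫ =
      a * ⟪ν₁, J (deriv γ₁ 0)⟫ - ℓ * b := by
    have h := free_flight_directional_derivative
      (hγ₁.differentiable one_ne_zero 0) (hγ₂.differentiable one_ne_zero 0) hx₂d htd hx₂0
      (by simpa only [hR] using heq) a b
    have hν : ⟪ν₁, Complex.I * v₁⟫ = 0 := by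
      simp [hν₁, Complex.inner]
      ring
    have hνν : ⟪ν₁, Complex.I * (Complex.I * v₁)⟫ = -‖v₁‖ := by
      rw [← mul_assoc, Complex.I_mul_I, neg_one_mul, inner_neg_right, hν₁,
        real_inner_smul_left, real_inner_self_eq_norm_mul_norm, inv_mul_cancel_left₀ hv]
    have h' := congrArg (fun w => ⟪ν₁, Complex.I * w⟫) h
    simp only [mul_add, mul_smul_comm, inner_add_right, real_inner_smul_right, hν, hνν,
      ht0] at h'
    rw [hJ, hJ, h']
    field_simp
    ring
  constructor
  · rw [eq_div_iff hne, key]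
    ring
  · rw [eq_div_iff hne, key]
    ring
end

section
/- (Second row of the differential of the lensed billiard map, reflection case.) Work in ℝ² with the standard inner product; let R_θ denote rotation by angle θ counterclockwise and J = R_{π/2}. Let γ₁ be C¹ and γ₂ be C² curves ℝ → ℝ² with ‖γᵢ'(x)‖ = 1; set tᵢ(x) := γᵢ'(x), nᵢ(x) := J tᵢ(x), κ(x) := ⟨γ₂''(x), n₂(x)⟩, 𝒪ᵢ := γᵢ(0), ℓ := ‖𝒪₂ − 𝒪₁‖. Let v₁ ≠ 0 with 𝒪₂ = 𝒪₁ + (ℓ/‖v₁‖) • v₁, and let v₂ := v₁ − 2⟨v₁, n₂(0)⟩ • n₂(0); set νᵢ := vᵢ/‖vᵢ‖. Suppose x₂, t, θ₂ : ℝ × ℝ → ℝ are differentiable at (0,0) with x₂(0,0) = 0, θ₂(0,0) = 0, t(0,0) = ℓ/‖v₁‖, and for all (x₁, θ₁) near (0,0): γ₂(x₂(x₁,θ₁)) = γ₁(x₁) + t(x₁,θ₁) • (R_{θ₁} v₁) and R_{θ₂(x₁,θ₁)} v₂ = R_{θ₁} v₁ − 2⟨R_{θ₁} v₁, n₂(x₂(x₁,θ₁))⟩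 • n₂(x₂(x₁,θ₁)). If ⟨ν₁, n₂(0)⟩ ≠ 0 and ⟨ν₂, n₂(0)⟩ ≠ 0, then ∂θ₂/∂x₁(0,0) = −2 κ(0) ⟨ν₁, n₁(0)⟩ / ⟨ν₂, n₂(0)⟩ and ∂θ₂/∂θ₁(0,0) = ⟨ν₁, n₂(0)⟩/⟨ν₂, n₂(0)⟩ + 2 κ(0) ℓ / ⟨ν₂, n₂(0)⟩. -/
open scoped RealInnerProductSpace

/-- The derivative of a rotated vector, the rotation angle being zero at the base point. -/
lemma HasDerivAt.exp_mul_I_mul {θ : ℝ → ℝ} {Θ : ℝ} (hθ : HasDerivAt θ Θ 0) (h0 : θ 0 = 0)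
    (v : ℂ) :
    HasDerivAt (fun s => Complex.exp (θ s * Complex.I) * v) (Θ * Complex.I * v) 0 := by
  simpa [h0] using ((hθ.ofReal_comp.mul_const Complex.I).cexp).mul_const v

/-- Linearization of the free-flight equation along a curve of initial states. -/
lemma linearized_free_flight {γ₁ γ₂ : ℝ → ℂ} (hγ₁ : DifferentiableAt ℝ γ₁ 0)
    (hγ₂ : DifferentiableAt ℝ γ₂ 0) {u φ x t : ℝ → ℝ} {a b X T : ℝ} {v : ℂ}
    (hu : HasDerivAt u a 0) (hφ : HasDerivAt φ b 0) (hx : HasDerivAt x X 0)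
    (ht : HasDerivAt t T 0) (hu0 : u 0 = 0) (hφ0 : φ 0 = 0) (hx0 : x 0 = 0)
    (heq : ∀ᶠ s in nhds (0 : ℝ),
      γ₂ (x s) = γ₁ (u s) + t s • (Complex.exp (φ s * Complex.I) * v)) :
    X • deriv γ₂ 0 = a • deriv γ₁ 0 + T • v + (t 0 * b) • (Complex.I * v) := by
  have h1 : HasDerivAt (fun s => γ₂ (x s)) (X • deriv γ₂ 0) 0 :=
    HasDerivAt.scomp (0 : ℝ) (by rw [hx0]; exact hγ₂.hasDerivAt) hx
  have h2 : HasDerivAt (fun s => γ₁ (u s)) (a • deriv γ₁ 0) 0 :=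
    HasDerivAt.scomp (0 : ℝ) (by rw [hu0]; exact hγ₁.hasDerivAt) hu
  have h3 := h2.add (ht.smul (hφ.exp_mul_I_mul hφ0 v))
  rw [h1.unique (h3.congr_of_eventuallyEq heq)]
  simp [hφ0]
  ring

/-- Linearization of the law of reflection along a curve of initial states. -/
lemma linearized_reflection {γ : ℝ → ℂ} (hγ : DifferentiableAt ℝ (deriv γ) 0)
    {φ θ x : ℝ → ℝ} {b X Θ : ℝ} {v w : ℂ}
    (hφ : HasDerivAt φ b 0) (hθ : HasDerivAt θ Θ 0) (hx : HasDerivAt x X 0)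
    (hφ0 : φ 0 = 0) (hθ0 : θ 0 = 0) (hx0 : x 0 = 0)
    (hrefl : ∀ᶠ s in nhds (0 : ℝ),
      Complex.exp (θ s * Complex.I) * w = Complex.exp (φ s * Complex.I) * v -
        (2 * ⟪Complex.exp (φ s * Complex.I) * v, Complex.I * deriv γ (x s)⟫) •
          (Complex.I * deriv γ (x s))) :
    Θ • (Complex.I * w) = b • (Complex.I * v) -
      ((2 * ⟪v, Complex.I * deriv γ 0⟫) • (X • (Complex.I * deriv (deriv γ) 0)) +
        (2 * (⟪v, X • (Complex.I * deriv (deriv γ) 0)⟫ +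
          ⟪b • (Complex.I * v), Complex.I * deriv γ 0⟫)) • (Complex.I * deriv γ 0)) := by
  have hn : HasDerivAt (fun s => Complex.I * deriv γ (x s))
      (Complex.I * (X • deriv (deriv γ) 0)) 0 :=
    HasDerivAt.const_mul Complex.I (HasDerivAt.scomp (h := x) (g₁ := deriv γ) (0 : ℝ)
      (by rw [hx0]; exact hγ.hasDerivAt) hx)
  have hv := hφ.exp_mul_I_mul hφ0 v
  have h := (hθ.exp_mul_I_mul hθ0 w).unique
    ((hv.sub (((hv.inner ℝ hn).const_mul 2).smul hn)).congr_of_eventuallyEq hrefl)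
  simpa [hφ0, hx0, mul_assoc, mul_left_comm] using h

/-- In a unit frame `(τ, iτ)`, the linearized free-flight and reflection equations determine the
variation `Θ` of the outgoing angle. -/
lemma outgoing_angle_variation {τ τ₁ A v w : ℂ} {a b X T Θ c : ℝ} (hτ : ‖τ‖ = 1)
    (hw : w = v - (2 * ⟪v, Complex.I * τ⟫) • (Complex.I * τ))
    (hflight : X • τ = a • τ₁ + T • v + c • (Complex.I * v))
    (hrefl : Θ • (Complex.I * w) = b • (Complex.I * v) -
      ((2 * ⟪v, Complex.I * τ⟫) • (X • (Complex.I * A)) +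
        (2 * (⟪v, X • (Complex.I * A)⟫ +
          ⟪b • (Complex.I * v), Complex.I * τ⟫)) • (Complex.I * τ))) :
    Θ * ⟪v, Complex.I * τ⟫ = 2 * ⟪A, Complex.I * τ⟫ * (a * ⟪v, Complex.I * τ₁⟫ - c * ‖v‖ ^ 2) -
      b * ⟪v, Complex.I * τ⟫ := by
  have hX : X * ⟪v, Complex.I * τ⟫ = a * ⟪v, Complex.I * τ₁⟫ - c * ‖v‖ ^ 2 := by
    have h := congrArg (fun z : ℂ => ⟪v, Complex.I * z⟫) hflight
    simp only [Complex.inner, Complex.sq_norm, Complex.normSq_apply] at h ⊢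
    simp at h ⊢
    linarith
  have hΘ : Θ * ⟪v, Complex.I * τ⟫ =
      2 * ⟪A, Complex.I * τ⟫ * (X * ⟪v, Complex.I * τ⟫) - b * ⟪v, Complex.I * τ⟫ := by
    have hskew : ∀ z : ℂ, ⟪τ, Complex.I * z⟫ = -⟪z, Complex.I * τ⟫ := by
      intro z
      simp [Complex.inner]
      ring
    have hn : ⟪Complex.I * τ, Complex.I * τ⟫ = 1 := by
      rw [real_inner_self_eq_norm_sq]
      simp [hτ]
    have hwn : ⟪w, Complex.I * τ⟫ = -⟪v, Complex.I * τ⟫ := by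
      rw [hw, inner_sub_left, real_inner_smul_left, hn]
      ring
    have hτn : ⟪τ, Complex.I * τ⟫ = 0 := by
      simp [Complex.inner]
      ring
    have h := congrArg (fun z : ℂ => ⟪τ, z⟫) hrefl
    simp only [inner_sub_right, inner_add_right, real_inner_smul_right, hskew w, hskew v,
      hskew A, hτn, hwn] at h
    linarith
  rw [hΘ, hX]

/-- **Second row of the differential of the lensed billiard map, reflection
case.**  We work in `ℝ² ≅ ℂ`; `R θ` is rotation by `θ` counterclockwise and
`J = R_{π/2}`.  `γ₁` (`C¹`) and `γ₂` (`C²`) are unit-speed boundary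
parametrizations with tangents `tᵢ = γᵢ'`, normals `nᵢ = J γᵢ'`, geodesic
curvature `κ x = ⟪γ₂'' x, n₂ x⟫`, `𝒪ᵢ = γᵢ 0`, `ℓ = ‖𝒪₂ - 𝒪₁‖`, `v₁ ≠ 0` with
`𝒪₂ = 𝒪₁ + (ℓ/‖v₁‖) • v₁`, reflected velocity `v₂ = v₁ - 2⟪v₁, n₂ 0⟫ • n₂ 0`,
and `νᵢ = vᵢ/‖vᵢ‖`.  If `x₂, t, θ₂` satisfy the free-flight and reflection
equations near `(0,0)`, then
`∂θ₂/∂x₁ (0,0) = -2 κ 0 ⟪ν₁, n₁ 0⟫ / ⟪ν₂, n₂ 0⟫` and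
`∂θ₂/∂θ₁ (0,0) = ⟪ν₁, n₂ 0⟫/⟪ν₂, n₂ 0⟫ + 2 κ 0 ℓ / ⟪ν₂, n₂ 0⟫`. -/
theorem lensed_billiard_differential_second_row_reflection
    (R : ℝ → ℂ → ℂ) (hR : ∀ (θ : ℝ) (v : ℂ), R θ v = Complex.exp (θ * Complex.I) * v)
    (J : ℂ → ℂ) (hJ : ∀ v : ℂ, J v = Complex.I * v)
    (γ₁ γ₂ : ℝ → ℂ) (hγ₁ : ContDiff ℝ 1 γ₁) (hγ₂ : ContDiff ℝ 2 γ₂)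
    (hunit₁ : ∀ x : ℝ, ‖deriv γ₁ x‖ = 1) (hunit₂ : ∀ x : ℝ, ‖deriv γ₂ x‖ = 1)
    (κ : ℝ → ℝ) (hκ : ∀ x : ℝ, κ x = ⟪deriv (deriv γ₂) x, J (deriv γ₂ x)⟫)
    (ℓ : ℝ) (hℓ : ℓ = ‖γ₂ 0 - γ₁ 0‖)
    (v₁ : ℂ) (hv₁ : v₁ ≠ 0)
    (hO₂ : γ₂ 0 = γ₁ 0 + (ℓ / ‖v₁‖) • v₁)
    (v₂ : ℂ) (hv₂ : v₂ = v₁ - (2 * ⟪v₁, J (deriv γ₂ 0)⟫) • J (deriv γ₂ 0))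
    (ν₁ ν₂ : ℂ) (hν₁ : ν₁ = ‖v₁‖⁻¹ • v₁) (hν₂ : ν₂ = ‖v₂‖⁻¹ • v₂)
    (x₂ t θ₂ : ℝ × ℝ → ℝ)
    (hx₂d : DifferentiableAt ℝ x₂ (0, 0)) (htd : DifferentiableAt ℝ t (0, 0))
    (hθ₂d : DifferentiableAt ℝ θ₂ (0, 0))
    (hx₂0 : x₂ (0, 0) = 0) (hθ₂0 : θ₂ (0, 0) = 0) (ht0 : t (0, 0) = ℓ / ‖v₁‖)
    (heq : ∀ᶠ p : ℝ × ℝ in nhds (0, 0), γ₂ (x₂ p) = γ₁ p.1 + t p • R p.2 v₁)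
    (hrefl : ∀ᶠ p : ℝ × ℝ in nhds (0, 0),
      R (θ₂ p) v₂ =
        R p.2 v₁ - (2 * ⟪R p.2 v₁, J (deriv γ₂ (x₂ p))⟫) • J (deriv γ₂ (x₂ p)))
    (hne₁ : ⟪ν₁, J (deriv γ₂ 0)⟫ ≠ 0) (hne₂ : ⟪ν₂, J (deriv γ₂ 0)⟫ ≠ 0) :
    fderiv ℝ θ₂ (0, 0) (1, 0) =
        -2 * κ 0 * ⟪ν₁, J (deriv γ₁ 0)⟫ / ⟪ν₂, J (deriv γ₂ 0)⟫ ∧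
      fderiv ℝ θ₂ (0, 0) (0, 1) =
        ⟪ν₁, J (deriv γ₂ 0)⟫ / ⟪ν₂, J (deriv γ₂ 0)⟫ +
          2 * κ 0 * ℓ / ⟪ν₂, J (deriv γ₂ 0)⟫ := by
  obtain rfl : R = fun (θ : ℝ) v => Complex.exp (θ * Complex.I) * v := by ext θ v; exact hR θ v
  obtain rfl : J = fun v => Complex.I * v := by ext v; exact hJ v
  dsimp only at *
  have hd₁ : DifferentiableAt ℝ γ₁ 0 := hγ₁.differentiable (by norm_num) 0
  have hd₂ : DifferentiableAt ℝ γ₂ 0 := hγ₂.differentiable (by norm_num) 0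
  have hdd : DifferentiableAt ℝ (deriv γ₂) 0 := hγ₂.differentiable_deriv_two 0
  have hβ : ⟪v₁, Complex.I * deriv γ₂ 0⟫ ≠ 0 := by
    intro h
    exact hne₁ (by rw [hν₁, real_inner_smul_left, h, mul_zero])
  have hnn : ⟪Complex.I * deriv γ₂ 0, Complex.I * deriv γ₂ 0⟫ = 1 := by
    rw [real_inner_self_eq_norm_sq]
    simp [hunit₂]
  have hnorm : ‖v₂‖ = ‖v₁‖ := by
    rw [← sq_eq_sq₀ (norm_nonneg _) (norm_nonneg _), hv₂, norm_sub_sq_real, norm_smul, mul_pow,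
      ← real_inner_self_eq_norm_sq (Complex.I * deriv γ₂ 0), hnn, real_inner_smul_right,
      Real.norm_eq_abs, sq_abs]
    ring
  have hv₂n : ⟪v₂, Complex.I * deriv γ₂ 0⟫ = -⟪v₁, Complex.I * deriv γ₂ 0⟫ := by
    rw [hv₂, inner_sub_left, real_inner_smul_left, hnn]
    ring
  have hr : ‖v₁‖ ≠ 0 := norm_ne_zero_iff.mpr hv₁
  have key : ∀ a b : ℝ, fderiv ℝ θ₂ (0, 0) (a, b) * ⟪v₁, Complex.I * deriv γ₂ 0⟫ =
      2 * κ 0 * (a * ⟪v₁, Complex.I * deriv γ₁ 0⟫ - ℓ * b * ‖v₁‖) -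
        b * ⟪v₁, Complex.I * deriv γ₂ 0⟫ := by
    intro a b
    have hline : HasDerivAt (fun s : ℝ => (s * a, s * b)) (a, b) 0 := by
      simpa using ((hasDerivAt_id (0 : ℝ)).mul_const a).prodMk
        ((hasDerivAt_id (0 : ℝ)).mul_const b)
    have hlim : Filter.Tendsto (fun s : ℝ => (s * a, s * b)) (nhds 0) (nhds (0, 0)) := by
      simpa using hline.continuousAt.tendsto
    have along : ∀ f : ℝ × ℝ → ℝ, DifferentiableAt ℝ f (0, 0) →
        HasDerivAt (fun s : ℝ => f (s * a, s * b)) (fderiv ℝ f (0, 0) (a, b)) 0 :=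
      fun f hf => HasFDerivAt.comp_hasDerivAt (0 : ℝ)
        (by simpa using hf.hasFDerivAt) hline
    have hfl := linearized_free_flight hd₁ hd₂ (along Prod.fst differentiableAt_fst)
      (along Prod.snd differentiableAt_snd) (along x₂ hx₂d) (along t htd) (by simp) (by simp)
      (by simpa using hx₂0) (hlim.eventually heq)
    have hre := linearized_reflection hdd (along Prod.snd differentiableAt_snd)
      (along θ₂ hθ₂d) (along x₂ hx₂d) (by simp) (by simpa using hθ₂0) (by simpa using hx₂0)
      (hlim.eventually hrefl)
    rw [outgoing_angle_variation (hunit₂ 0) hv₂ hfl hre, hκ]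
    simp only [zero_mul, ht0, fderiv_fst, fderiv_snd, ContinuousLinearMap.coe_fst',
      ContinuousLinearMap.coe_snd']
    field_simp
  have h₁ := key 1 0
  have h₂ := key 0 1
  simp only [hν₁, hν₂, hnorm, real_inner_smul_left, hv₂n]
  constructor
  · field_simp
    linarith
  · field_simp
    linarith
end
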